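/- arXiv:2601.19284 — 2 statements merged into one kernel-verified Lean document; each statement's English description precedes it below -/
import Mathlib

section
/- Let γ ∈ (0,1], ν > 0, K ∈ S_γ(ν), and set r₀ = min{D, ν/G} with D = 1/(8κ³ψφ) and G = 16κ⁹ℓ₁ψφ. Then every K' ∈ ℝ^{m×p} with ‖K' − K‖ ≤ r₀ satisfies K' ∈ S_γ(2ν), i.e., K' ∈ S_γ and J_γ(K') ≤ 2ν. -/
open Matrix

noncomputable section

/-- Spectral radius of a real square matrix: the largest modulus of a complex eigenvalue. -/
def specRad {n : ℕ} (M : Matrix (Fin n) (Fin n) ℝ) : ℝ :=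
  sSup {r : ℝ | ∃ μ ∈ spectrum ℂ (M.map (algebraMap ℝ ℂ)), r = ‖μ‖}

/-- Spectral (ℓ²→ℓ² operator) norm of a real matrix. -/
def spNorm {a b : ℕ} (M : Matrix (Fin a) (Fin b) ℝ) : ℝ :=
  ‖LinearMap.toContinuousLinearMap (Matrix.toEuclideanLin M)‖

/-- Frobenius norm of a real matrix. -/
def frobNorm {a b : ℕ} (M : Matrix (Fin a) (Fin b) ℝ) : ℝ :=
  Real.sqrt (∑ i, ∑ j, (M i j) ^ 2)

/-- Euclidean norm of a vector. -/
def vecNorm {a : ℕ} (x : Fin a → ℝ) : ℝ :=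
  Real.sqrt (∑ i, (x i) ^ 2)

variable {n m p : ℕ}

/-- Closed-loop matrix `A - BKC`. -/
def Acl (A : Matrix (Fin n) (Fin n) ℝ) (B : Matrix (Fin n) (Fin m) ℝ)
    (C : Matrix (Fin p) (Fin n) ℝ) (K : Matrix (Fin m) (Fin p) ℝ) : Matrix (Fin n) (Fin n) ℝ :=
  A - B * K * C

/-- Membership in the stabilizing set `S_γ`: `√γ · ρ(A − BKC) < 1`. -/
def inS (A : Matrix (Fin n) (Fin n) ℝ) (B : Matrix (Fin n) (Fin m) ℝ)
    (C : Matrix (Fin p) (Fin n) ℝ) (γ : ℝ) (K : Matrix (Fin m) (Fin p) ℝ) : Prop :=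
  Real.sqrt γ * specRad (Acl A B C K) < 1

/-- The solution `P_K(γ) = Σ_{t} γ^t ((A−BKC)ᵀ)^t (Q + CᵀKᵀRKC) (A−BKC)^t` of the
discounted Lyapunov equation. -/
def Pmat (A : Matrix (Fin n) (Fin n) ℝ) (B : Matrix (Fin n) (Fin m) ℝ)
    (C : Matrix (Fin p) (Fin n) ℝ) (Q : Matrix (Fin n) (Fin n) ℝ) (R : Matrix (Fin m) (Fin m) ℝ)
    (γ : ℝ) (K : Matrix (Fin m) (Fin p) ℝ) : Matrix (Fin n) (Fin n) ℝ :=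
  ∑' t : ℕ, γ ^ t • ((Acl A B C K)ᵀ ^ t * (Q + Cᵀ * Kᵀ * R * K * C) * (Acl A B C K) ^ t)

/-- The Gramian `Σ_K(γ) = Σ_{t} γ^t (A−BKC)^t ((A−BKC)ᵀ)^t`. -/
def Smat (A : Matrix (Fin n) (Fin n) ℝ) (B : Matrix (Fin n) (Fin m) ℝ)
    (C : Matrix (Fin p) (Fin n) ℝ) (γ : ℝ) (K : Matrix (Fin m) (Fin p) ℝ) :
    Matrix (Fin n) (Fin n) ℝ :=
  ∑' t : ℕ, γ ^ t • ((Acl A B C K) ^ t * ((Acl A B C K)ᵀ) ^ t)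

/-- The discounted cost `J_γ(K) = Tr(P_K(γ))`. -/
def Jcost (A : Matrix (Fin n) (Fin n) ℝ) (B : Matrix (Fin n) (Fin m) ℝ)
    (C : Matrix (Fin p) (Fin n) ℝ) (Q : Matrix (Fin n) (Fin n) ℝ) (R : Matrix (Fin m) (Fin m) ℝ)
    (γ : ℝ) (K : Matrix (Fin m) (Fin p) ℝ) : ℝ :=
  (Pmat A B C Q R γ K).trace

/-- `E_K = (R + γBᵀP_K(γ)B)KC − γBᵀP_K(γ)A`. -/
def Egrad (A : Matrix (Fin n) (Fin n) ℝ) (B : Matrix (Fin n) (Fin m) ℝ)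
    (C : Matrix (Fin p) (Fin n) ℝ) (Q : Matrix (Fin n) (Fin n) ℝ) (R : Matrix (Fin m) (Fin m) ℝ)
    (γ : ℝ) (K : Matrix (Fin m) (Fin p) ℝ) : Matrix (Fin m) (Fin n) ℝ :=
  (R + γ • (Bᵀ * Pmat A B C Q R γ K * B)) * K * C - γ • (Bᵀ * Pmat A B C Q R γ K * A)

/-- The closed-form gradient `∇J_γ(K) = 2 E_K Σ_K(γ) Cᵀ`. -/
def gradJ (A : Matrix (Fin n) (Fin n) ℝ) (B : Matrix (Fin n) (Fin m) ℝ)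
    (C : Matrix (Fin p) (Fin n) ℝ) (Q : Matrix (Fin n) (Fin n) ℝ) (R : Matrix (Fin m) (Fin m) ℝ)
    (γ : ℝ) (K : Matrix (Fin m) (Fin p) ℝ) : Matrix (Fin m) (Fin p) ℝ :=
  (2 : ℝ) • (Egrad A B C Q R γ K * Smat A B C γ K * Cᵀ)

end

section Lyapunov
variable {k l : ℕ}

theorem norm_le_specRad (M : Matrix (Fin k) (Fin k) ℝ) {μ : ℂ}
    (hμ : μ ∈ spectrum ℂ (M.map (algebraMap ℝ ℂ))) : ‖μ‖ ≤ specRad M := by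
  refine le_csSup ?_ ⟨μ, hμ, rfl⟩
  have h := (Matrix.finite_spectrum (M.map (algebraMap ℝ ℂ))).image (fun μ => ‖μ‖)
  refine (h.subset ?_).bddAbove
  rintro r ⟨μ, hμ, rfl⟩
  exact ⟨μ, hμ, rfl⟩

theorem specRad_lt (M : Matrix (Fin k) (Fin k) ℝ) {c : ℝ} (hc : 0 < c)
    (h : ∀ μ ∈ spectrum ℂ (M.map (algebraMap ℝ ℂ)), ‖μ‖ < c) : specRad M < c := by
  unfold specRad
  set S := {r : ℝ | ∃ μ ∈ spectrum ℂ (M.map (algebraMap ℝ ℂ)), r = ‖μ‖} with hS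
  rcases S.eq_empty_or_nonempty with h0 | h0
  · rwa [h0, Real.sSup_empty]
  · have hf : S.Finite := by
      refine ((Matrix.finite_spectrum (M.map (algebraMap ℝ ℂ))).image (fun μ => ‖μ‖)).subset ?_
      rintro r ⟨μ, hμ, rfl⟩
      exact ⟨μ, hμ, rfl⟩
    obtain ⟨μ, hμ, hr⟩ := h0.csSup_mem hf
    rw [hr]
    exact h μ hμ

open Matrix.Norms.Frobenius in
theorem summable_pow_mul_frobenius_norm_sq (hk : 1 ≤ k) (M : Matrix (Fin k) (Fin k) ℝ) {γ : ℝ}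
    (hγ : 0 < γ) (h : √γ * specRad M < 1) :
    Summable fun t : ℕ => γ ^ t * ‖M ^ t‖ ^ 2 := by
  have : Nonempty (Fin k) := ⟨⟨0, hk⟩⟩
  have : CompleteSpace (Matrix (Fin k) (Fin k) ℂ) := FiniteDimensional.complete ℂ _
  have hsg : 0 < √γ := Real.sqrt_pos.2 hγ
  have hlt : specRad M < 1 / √γ := by rwa [lt_div_iff₀ hsg, mul_comm]
  obtain ⟨r, hr1, hr2⟩ := exists_between (max_lt hlt (by positivity : (0:ℝ) < 1 / √γ))
  have hr0 : 0 < r := (le_max_right _ _).trans_lt hr1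
  lift r to NNReal using hr0.le
  set a := M.map (algebraMap ℝ ℂ) with ha
  have hrad : spectralRadius ℂ a < (r : ENNReal) := by
    refine spectrum.spectralRadius_lt_of_forall_lt a fun z hz => ?_
    rw [← NNReal.coe_lt_coe]
    exact (norm_le_specRad M hz).trans_lt ((le_max_left _ _).trans_lt hr1)
  have hnorm : ∀ t : ℕ, ‖M ^ t‖ = ‖a ^ t‖ := fun t => by
    rw [ha, ← Matrix.map_pow]
    exact (Matrix.frobenius_norm_map_eq _ _ (fun x => by simp)).symm
  have hev : ∀ᶠ t : ℕ in Filter.atTop, ‖M ^ t‖ ≤ r ^ t := by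
    filter_upwards [(spectrum.pow_norm_pow_one_div_tendsto_nhds_spectralRadius a).eventually
      (gt_mem_nhds hrad), Filter.eventually_gt_atTop 0] with t ht ht0
    have h1 : ‖a ^ t‖ ^ (1 / (t : ℝ)) < r := by
      rw [← ENNReal.ofReal_coe_nnreal] at ht
      exact (ENNReal.ofReal_lt_ofReal_iff hr0).1 ht
    have h3 := pow_le_pow_left₀ (by positivity) h1.le t
    rw [← Real.rpow_natCast, ← Real.rpow_mul (norm_nonneg _), one_div,
      inv_mul_cancel₀ (by positivity), Real.rpow_one] at h3
    rw [hnorm]; exact h3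
  have hγr : γ * r ^ 2 < 1 := by
    have h4 : √γ * r < 1 := by rwa [lt_div_iff₀ hsg, mul_comm] at hr2
    have h5 : (√γ * r) ^ 2 < 1 := pow_lt_one₀ (by positivity) h4 (by norm_num)
    rwa [mul_pow, Real.sq_sqrt hγ.le] at h5
  refine Summable.of_norm_bounded_eventually_nat
    (summable_geometric_of_lt_one (by positivity) hγr) ?_
  filter_upwards [hev] with t ht
  rw [Real.norm_of_nonneg (by positivity), mul_pow, ← pow_mul, mul_comm 2 t, pow_mul]
  gcongr

open Matrix.Norms.Frobenius in
theorem summable_lyapunov (hk : 1 ≤ k) (M W : Matrix (Fin k) (Fin k) ℝ) {γ : ℝ}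
    (hγ : 0 < γ) (h : √γ * specRad M < 1) :
    Summable fun t : ℕ => γ ^ t • (Mᵀ ^ t * W * M ^ t) := by
  have : CompleteSpace (Matrix (Fin k) (Fin k) ℝ) := FiniteDimensional.complete ℝ _
  refine Summable.of_norm_bounded ((summable_pow_mul_frobenius_norm_sq hk M hγ h).mul_right ‖W‖)
    fun t => ?_
  rw [norm_smul, Real.norm_of_nonneg (by positivity), ← Matrix.transpose_pow, mul_assoc (γ ^ t)]
  gcongr
  calc ‖(M ^ t)ᵀ * W * M ^ t‖ ≤ ‖(M ^ t)ᵀ‖ * ‖W‖ * ‖M ^ t‖ :=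
        (norm_mul_le _ _).trans (by gcongr; exact norm_mul_le _ _)
    _ = ‖M ^ t‖ ^ 2 * ‖W‖ := by rw [Matrix.frobenius_norm_transpose]; ring

theorem spNorm_nonneg (M : Matrix (Fin k) (Fin l) ℝ) : 0 ≤ spNorm M := norm_nonneg _

theorem mulVec_dotProduct_self_le (M : Matrix (Fin k) (Fin l) ℝ) {c : ℝ} (h : spNorm M ≤ c)
    (v : Fin l → ℝ) : M *ᵥ v ⬝ᵥ M *ᵥ v ≤ c ^ 2 * (v ⬝ᵥ v) := by
  have hsq : ∀ {j : ℕ} (w : Fin j → ℝ), w ⬝ᵥ w = ‖WithLp.toLp 2 w‖ ^ 2 := fun w => by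
    rw [EuclideanSpace.real_norm_sq_eq]; simp [dotProduct, sq]
  have h1 : ‖WithLp.toLp 2 (M *ᵥ v)‖ ≤ c * ‖WithLp.toLp 2 v‖ :=
    ((LinearMap.toContinuousLinearMap (Matrix.toEuclideanLin M)).le_opNorm
      (WithLp.toLp 2 v)).trans (mul_le_mul_of_nonneg_right h (norm_nonneg _))
  rw [hsq, hsq, ← mul_pow]
  exact pow_le_pow_left₀ (norm_nonneg _) h1 2

theorem dotProduct_self_nonneg (v : Fin k → ℝ) : 0 ≤ v ⬝ᵥ v :=
  Finset.sum_nonneg fun i _ => mul_self_nonneg (v i)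

theorem dotProduct_transpose_mul_mulVec (X : Matrix (Fin k) (Fin k) ℝ)
    (M : Matrix (Fin k) (Fin l) ℝ) (v : Fin l → ℝ) :
    v ⬝ᵥ (Mᵀ * X * M) *ᵥ v = M *ᵥ v ⬝ᵥ X *ᵥ (M *ᵥ v) := by
  rw [← mulVec_mulVec, ← mulVec_mulVec, dotProduct_mulVec, vecMul_transpose]

theorem trace_eq_sum_dotProduct_mulVec (X : Matrix (Fin k) (Fin k) ℝ) :
    X.trace = ∑ i, Pi.single i 1 ⬝ᵥ X *ᵥ Pi.single i (1 : ℝ) := by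
  simp [Matrix.trace]

/-- The quadratic form of a positive semidefinite matrix is bounded by its trace. -/
theorem dotProduct_mulVec_le_trace_mul (X : Matrix (Fin k) (Fin k) ℝ)
    (hX : ∀ v, 0 ≤ v ⬝ᵥ X *ᵥ v) (v : Fin k → ℝ) : v ⬝ᵥ X *ᵥ v ≤ X.trace * (v ⬝ᵥ v) := by
  have h : ∀ i j, 0 ≤ v j * v j * X i i - v i * X i j * v j - v j * X j i * v i
      + v i * v i * X j j := fun i j => by
    have := hX (v j • Pi.single i 1 - v i • Pi.single j 1)
    simp only [mulVec_sub, mulVec_smul, mulVec_single_one, sub_dotProduct, dotProduct_sub,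
      smul_dotProduct, dotProduct_smul, single_dotProduct, col_apply, smul_eq_mul, one_mul] at this
    linarith
  have hs := Finset.sum_nonneg fun i (_ : i ∈ Finset.univ) =>
    Finset.sum_nonneg fun j (_ : j ∈ Finset.univ) => h i j
  simp only [Finset.sum_add_distrib, Finset.sum_sub_distrib, ← Finset.sum_mul,
    ← Finset.mul_sum] at hs
  have h1 : v ⬝ᵥ X *ᵥ v = ∑ i, ∑ j, v i * X i j * v j := by
    simp [dotProduct, mulVec, Finset.mul_sum, mul_assoc]
  have h2 : v ⬝ᵥ X *ᵥ v = ∑ i, (∑ j, v j * X j i) * v i := by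
    simp_rw [Finset.sum_mul]; exact h1.trans Finset.sum_comm
  have h3 : X.trace * (v ⬝ᵥ v) = (∑ i, v i * v i) * ∑ i, X i i := by
    rw [mul_comm]; rfl
  linarith

theorem dotProduct_mulVec_sub_le (X : Matrix (Fin k) (Fin k) ℝ) (hX : ∀ v, 0 ≤ v ⬝ᵥ X *ᵥ v)
    {s : ℝ} (hs : 0 < s) (x y : Fin k → ℝ) :
    (x - y) ⬝ᵥ X *ᵥ (x - y) ≤ (1 + s) * (x ⬝ᵥ X *ᵥ x) + (1 + 1 / s) * (y ⬝ᵥ X *ᵥ y) := by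
  have h := hX (s • x + y)
  simp only [mulVec_add, mulVec_sub, mulVec_smul, sub_dotProduct, dotProduct_sub, add_dotProduct,
    dotProduct_add, smul_dotProduct, dotProduct_smul, smul_eq_mul] at h ⊢
  have h2 : 0 ≤ s * (x ⬝ᵥ X *ᵥ x) + y ⬝ᵥ X *ᵥ x + x ⬝ᵥ X *ᵥ y + 1 / s * (y ⬝ᵥ X *ᵥ y) := by
    have := mul_nonneg (one_div_pos.2 hs).le h
    field_simp at this ⊢
    linarith
  linarith

theorem hasSum_dotProduct_mulVec {f : ℕ → Matrix (Fin k) (Fin k) ℝ} {X : Matrix (Fin k) (Fin k) ℝ}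
    (h : HasSum f X) (v : Fin k → ℝ) : HasSum (fun t => v ⬝ᵥ f t *ᵥ v) (v ⬝ᵥ X *ᵥ v) :=
  h.map (AddMonoidHom.mk' (fun X : Matrix (Fin k) (Fin k) ℝ => v ⬝ᵥ X *ᵥ v)
    fun X Y => by simp [add_mulVec]) (by
      change Continuous fun X : Matrix (Fin k) (Fin k) ℝ => v ⬝ᵥ X *ᵥ v
      fun_prop)

theorem tsum_lyapunov_eq (M W : Matrix (Fin k) (Fin k) ℝ) (γ : ℝ)
    (h : Summable fun t : ℕ => γ ^ t • (Mᵀ ^ t * W * M ^ t)) :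
    ∑' t : ℕ, γ ^ t • (Mᵀ ^ t * W * M ^ t) =
      W + γ • (Mᵀ * (∑' t : ℕ, γ ^ t • (Mᵀ ^ t * W * M ^ t)) * M) := by
  conv_lhs => rw [h.tsum_eq_zero_add]
  rw [← h.tsum_mul_left, ← (h.mul_left _).tsum_mul_right, ← ((h.mul_left _).mul_right _).tsum_const_smul]
  congr 1
  · simp
  · refine tsum_congr fun t => ?_
    rw [pow_succ' Mᵀ, pow_succ M, pow_succ' γ]
    simp only [mul_smul_comm, smul_mul_assoc, smul_smul, Matrix.mul_assoc]

theorem dotProduct_pow_mulVec_nonneg (M W : Matrix (Fin k) (Fin k) ℝ) {γ : ℝ} (hγ : 0 ≤ γ)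
    (hW : ∀ v, 0 ≤ v ⬝ᵥ W *ᵥ v) (t : ℕ) (v : Fin k → ℝ) :
    0 ≤ v ⬝ᵥ (γ ^ t • (Mᵀ ^ t * W * M ^ t)) *ᵥ v := by
  rw [smul_mulVec, dotProduct_smul, ← transpose_pow, dotProduct_transpose_mul_mulVec]
  exact mul_nonneg (pow_nonneg hγ t) (hW _)

/-- A positive semidefinite supersolution of the Lyapunov equation dominates its solution. -/
theorem trace_tsum_lyapunov_le (M W X : Matrix (Fin k) (Fin k) ℝ) {γ : ℝ} (hγ : 0 ≤ γ)
    (hX : ∀ v, 0 ≤ v ⬝ᵥ X *ᵥ v)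
    (hsuper : ∀ v, v ⬝ᵥ W *ᵥ v + γ * (M *ᵥ v ⬝ᵥ X *ᵥ (M *ᵥ v)) ≤ v ⬝ᵥ X *ᵥ v) :
    (∑' t : ℕ, γ ^ t • (Mᵀ ^ t * W * M ^ t)).trace ≤ X.trace := by
  have hpart : ∀ (T : ℕ) (v : Fin k → ℝ),
      ∑ t ∈ Finset.range T, v ⬝ᵥ (γ ^ t • (Mᵀ ^ t * W * M ^ t)) *ᵥ v
        + γ ^ T * (M ^ T *ᵥ v ⬝ᵥ X *ᵥ (M ^ T *ᵥ v)) ≤ v ⬝ᵥ X *ᵥ v := fun T v => by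
    induction T with
    | zero => simp
    | succ T ih =>
      have h := mul_le_mul_of_nonneg_left (hsuper (M ^ T *ᵥ v)) (pow_nonneg hγ T)
      rw [mulVec_mulVec v M, ← pow_succ'] at h
      rw [Finset.sum_range_succ, smul_mulVec, dotProduct_smul, ← transpose_pow,
        dotProduct_transpose_mul_mulVec, smul_eq_mul, pow_succ γ]
      linarith
  rw [trace_eq_sum_dotProduct_mulVec, trace_eq_sum_dotProduct_mulVec]
  refine Finset.sum_le_sum fun i _ => ?_
  by_cases h : Summable fun t : ℕ => γ ^ t • (Mᵀ ^ t * W * M ^ t)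
  · refine le_of_tendsto (hasSum_dotProduct_mulVec h.hasSum _).tendsto_sum_nat
      (Filter.Eventually.of_forall fun T => ?_)
    exact (le_add_of_nonneg_right (mul_nonneg (pow_nonneg hγ T) (hX _))).trans (hpart T _)
  · rw [tsum_eq_zero_of_not_summable h, zero_mulVec, dotProduct_zero]
    exact hX _

/-- A positive definite supersolution of the Lyapunov equation certifies stability. -/
theorem sqrt_mul_specRad_lt_one (M W X : Matrix (Fin k) (Fin k) ℝ) {γ : ℝ} (hγ : 0 < γ)
    (hX : ∀ v, 0 ≤ v ⬝ᵥ X *ᵥ v) (hW : ∀ v, v ≠ 0 → 0 < v ⬝ᵥ W *ᵥ v)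
    (hsuper : ∀ v, v ⬝ᵥ W *ᵥ v + γ * (M *ᵥ v ⬝ᵥ X *ᵥ (M *ᵥ v)) ≤ v ⬝ᵥ X *ᵥ v) :
    √γ * specRad M < 1 := by
  have hsg : 0 < √γ := Real.sqrt_pos.2 hγ
  rw [mul_comm, ← lt_div_iff₀ hsg]
  refine specRad_lt M (by positivity) fun μ hμ => ?_
  rw [← Matrix.spectrum_toLin', ← Module.End.hasEigenvalue_iff_mem_spectrum] at hμ
  obtain ⟨u, hu⟩ := hμ.exists_hasEigenvector
  have hmul : M.map (algebraMap ℝ ℂ) *ᵥ u = μ • u := by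
    simpa [Matrix.toLin'_apply] using hu.apply_eq_smul
  set x : Fin k → ℝ := fun i => (u i).re with hx
  set y : Fin k → ℝ := fun i => (u i).im with hy
  have hMx : M *ᵥ x = μ.re • x - μ.im • y := by
    ext i
    have := congrArg Complex.re (congrFun hmul i)
    simpa [mulVec, dotProduct, hx, hy] using this
  have hMy : M *ᵥ y = μ.im • x + μ.re • y := by
    ext i
    have := congrArg Complex.im (congrFun hmul i)
    simpa [mulVec, dotProduct, hx, hy, add_comm] using this
  have hxy : x ≠ 0 ∨ y ≠ 0 := by
    by_contra! hc
    refine hu.2 (funext fun i => Complex.ext ?_ ?_)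
    · exact congrFun hc.1 i
    · exact congrFun hc.2 i
  have hW0 : ∀ v, 0 ≤ v ⬝ᵥ W *ᵥ v := fun v => by
    by_cases hv : v = 0
    · simp [hv]
    · exact (hW v hv).le
  have hpos : 0 < x ⬝ᵥ W *ᵥ x + y ⬝ᵥ W *ᵥ y := by
    rcases hxy with h | h
    · exact add_pos_of_pos_of_nonneg (hW _ h) (hW0 _)
    · exact add_pos_of_nonneg_of_pos (hW0 _) (hW _ h)
  have hsum : M *ᵥ x ⬝ᵥ X *ᵥ (M *ᵥ x) + M *ᵥ y ⬝ᵥ X *ᵥ (M *ᵥ y)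
      = ‖μ‖ ^ 2 * (x ⬝ᵥ X *ᵥ x + y ⬝ᵥ X *ᵥ y) := by
    rw [hMx, hMy, Complex.sq_norm, Complex.normSq_apply]
    simp only [mulVec_add, mulVec_sub, mulVec_smul, sub_dotProduct, dotProduct_sub,
      add_dotProduct, dotProduct_add, smul_dotProduct, dotProduct_smul, smul_eq_mul]
    ring
  have h1 : γ * ‖μ‖ ^ 2 * (x ⬝ᵥ X *ᵥ x + y ⬝ᵥ X *ᵥ y) < x ⬝ᵥ X *ᵥ x + y ⬝ᵥ X *ᵥ y := by
    rw [mul_assoc, ← hsum]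
    linarith [hsuper x, hsuper y]
  have h2 : γ * ‖μ‖ ^ 2 < 1 := by
    by_contra! hc
    nlinarith [hX x, hX y]
  rw [lt_div_iff₀ hsg]
  refine lt_of_pow_lt_pow_left₀ 2 zero_le_one ?_
  rw [mul_pow, Real.sq_sqrt hγ.le]
  linarith

theorem dotProduct_stageCost_mulVec {j : ℕ} (C : Matrix (Fin j) (Fin k) ℝ)
    (Q : Matrix (Fin k) (Fin k) ℝ) (R : Matrix (Fin l) (Fin l) ℝ) (K : Matrix (Fin l) (Fin j) ℝ)
    (v : Fin k → ℝ) : v ⬝ᵥ (Q + Cᵀ * Kᵀ * R * K * C) *ᵥ v =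
      v ⬝ᵥ Q *ᵥ v + K *ᵥ (C *ᵥ v) ⬝ᵥ R *ᵥ (K *ᵥ (C *ᵥ v)) := by
  rw [add_mulVec, dotProduct_add, ← transpose_mul, Matrix.mul_assoc _ K C,
    dotProduct_transpose_mul_mulVec, ← mulVec_mulVec]

theorem smul_dotProduct_le_of_posSemidef (X : Matrix (Fin k) (Fin k) ℝ) {c : ℝ}
    (h : (X - c • (1 : Matrix (Fin k) (Fin k) ℝ)).PosSemidef) (v : Fin k → ℝ) :
    c * (v ⬝ᵥ v) ≤ v ⬝ᵥ X *ᵥ v := by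
  simpa [sub_mulVec, smul_mulVec, dotProduct_sub] using h.dotProduct_mulVec_nonneg v

theorem dotProduct_le_smul_of_posSemidef (X : Matrix (Fin k) (Fin k) ℝ) {c : ℝ}
    (h : (c • (1 : Matrix (Fin k) (Fin k) ℝ) - X).PosSemidef) (v : Fin k → ℝ) :
    v ⬝ᵥ X *ᵥ v ≤ c * (v ⬝ᵥ v) := by
  simpa [sub_mulVec, smul_mulVec, dotProduct_sub] using h.dotProduct_mulVec_nonneg v

theorem perturbation_bounds {ℓ₀ ℓ₁ ν κ ψ φ r : ℝ} (hℓ₀ : 0 < ℓ₀) (hℓ₀₁ : ℓ₀ ≤ ℓ₁)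
    (hψ0 : 0 < ψ) (hφ0 : 0 < φ) (hr0 : 0 ≤ r) (hκ1 : 1 ≤ κ) (hκ2 : κ ^ 2 * ℓ₀ = ν)
    (h : r ≤ ν / (16 * κ ^ 9 * ℓ₁ * ψ * φ)) :
    ℓ₁ * (ψ * r * φ) ≤ ℓ₀ / 16 ∧ ν * (ψ * r * φ) ≤ ℓ₀ / 16 ∧ ψ * r * φ ≤ 1 / 16 := by
  have hℓ₁ : 0 < ℓ₁ := hℓ₀.trans_le hℓ₀₁
  have hκ0 : 0 < κ := zero_lt_one.trans_le hκ1
  set ε := ψ * r * φ with hε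
  have hε0 : 0 ≤ ε := by positivity
  have hεκ : 16 * (κ ^ 7 * (ℓ₁ * ε)) ≤ ℓ₀ := by
    rw [le_div_iff₀ (by positivity), ← hκ2] at h
    refine le_of_mul_le_mul_left ?_ (by positivity : 0 < κ ^ 2)
    rw [hε]
    linarith
  have hℓ₁ε : ℓ₁ * ε ≤ ℓ₀ / 16 := by
    have h := le_mul_of_one_le_left (by positivity : 0 ≤ ℓ₁ * ε) (one_le_pow₀ hκ1 : 1 ≤ κ ^ 7)
    linarith
  have hνε : ν * ε ≤ ℓ₀ / 16 := by
    have h : ν * ε ≤ κ ^ 7 * (ℓ₁ * ε) := by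
      rw [← hκ2, mul_assoc]
      have := pow_le_pow_right₀ hκ1 (by norm_num : 2 ≤ 7)
      gcongr
    linarith
  have hε1 : ε ≤ 1 / 16 := by
    refine le_of_mul_le_mul_left ?_ hℓ₁
    linarith
  exact ⟨hℓ₁ε, hνε, hε1⟩

/-- Pointwise form of the statement that doubling a Lyapunov solution `P` absorbs a perturbation
of the state by `y` and of the input by `b`, both small relative to `v`. -/
theorem two_mul_lyapunov_supersolution (P Q : Matrix (Fin k) (Fin k) ℝ)
    (R : Matrix (Fin l) (Fin l) ℝ) {γ ℓ₀ ℓ₁ ν ε : ℝ} (hγ0 : 0 < γ) (hγ1 : γ ≤ 1) (hℓ₀ : 0 < ℓ₀)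
    (hℓ₁ : 0 < ℓ₁) (hν : 0 < ν) (hε0 : 0 ≤ ε) (hℓ₁ε : ℓ₁ * ε ≤ ℓ₀ / 16)
    (hνε : ν * ε ≤ ℓ₀ / 16) (hε1 : ε ≤ 1 / 16) (hPpos : ∀ v, 0 ≤ v ⬝ᵥ P *ᵥ v)
    (hRpos : ∀ v, 0 ≤ v ⬝ᵥ R *ᵥ v) (hPub : ∀ v, v ⬝ᵥ P *ᵥ v ≤ ν * (v ⬝ᵥ v))
    (hRub : ∀ v, v ⬝ᵥ R *ᵥ v ≤ ℓ₁ * (v ⬝ᵥ v)) {v x y : Fin k → ℝ} {a b : Fin l → ℝ}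
    (hQv : ℓ₀ * (v ⬝ᵥ v) ≤ v ⬝ᵥ Q *ᵥ v)
    (hv : v ⬝ᵥ P *ᵥ v = v ⬝ᵥ Q *ᵥ v + a ⬝ᵥ R *ᵥ a + γ * (x ⬝ᵥ P *ᵥ x))
    (hy : y ⬝ᵥ y ≤ ε ^ 2 * (v ⬝ᵥ v)) (hb : b ⬝ᵥ b ≤ ε ^ 2 * (v ⬝ᵥ v)) :
    v ⬝ᵥ Q *ᵥ v + (a + b) ⬝ᵥ R *ᵥ (a + b) + γ * (2 * ((x - y) ⬝ᵥ P *ᵥ (x - y)))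
      ≤ 2 * (v ⬝ᵥ P *ᵥ v) := by
  have hV := dotProduct_self_nonneg v
  set V := v ⬝ᵥ v with hVdef
  have hyoung := dotProduct_mulVec_sub_le P hPpos (s := ℓ₀ / (8 * ν)) (by positivity) x y
  have hRab := dotProduct_mulVec_sub_le R hRpos one_pos a (-b)
  rw [sub_neg_eq_add, mulVec_neg, neg_dotProduct_neg] at hRab
  have hRb : b ⬝ᵥ R *ᵥ b ≤ ℓ₀ / 16 * V := by
    refine (hRub b).trans ?_
    have h1 := mul_le_mul_of_nonneg_left hb hℓ₁.le
    have h2 : ε ^ 2 ≤ ε := by nlinarith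
    have h3 : ℓ₁ * ε ^ 2 ≤ ℓ₀ / 16 := (mul_le_mul_of_nonneg_left h2 hℓ₁.le).trans hℓ₁ε
    have h4 := mul_le_mul_of_nonneg_right h3 hV
    linarith
  have hvub := hPub v
  have hPy : (1 + 1 / (ℓ₀ / (8 * ν))) * (y ⬝ᵥ P *ᵥ y) ≤ ℓ₀ / 16 * V := by
    have h1 : y ⬝ᵥ P *ᵥ y ≤ ν * (ε ^ 2 * V) :=
      (hPub _).trans (mul_le_mul_of_nonneg_left hy hν.le)
    have h2 : (1 + 1 / (ℓ₀ / (8 * ν))) * (ν * ε ^ 2) ≤ ℓ₀ / 16 := by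
      have h3 : (1 + 1 / (ℓ₀ / (8 * ν))) * (ν * ε ^ 2)
          = ν * ε * ε + 8 * (ν * ε) ^ 2 / ℓ₀ := by field_simp
      have h4 : ν * ε * ε ≤ ℓ₀ / 16 * (1 / 16) := by gcongr
      have h5 : 8 * (ν * ε) ^ 2 / ℓ₀ ≤ 8 * (ℓ₀ / 16) ^ 2 / ℓ₀ := by gcongr
      have h6 : 8 * (ℓ₀ / 16) ^ 2 / ℓ₀ = ℓ₀ / 32 := by field_simp; norm_num
      linarith
    calc _ ≤ (1 + 1 / (ℓ₀ / (8 * ν))) * (ν * (ε ^ 2 * V)) :=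
          mul_le_mul_of_nonneg_left h1 (by positivity)
      _ = (1 + 1 / (ℓ₀ / (8 * ν))) * (ν * ε ^ 2) * V := by ring
      _ ≤ _ := mul_le_mul_of_nonneg_right h2 hV
  have hsx : ℓ₀ / (8 * ν) * (γ * (x ⬝ᵥ P *ᵥ x)) ≤ ℓ₀ / 8 * V := by
    have h1 : γ * (x ⬝ᵥ P *ᵥ x) ≤ ν * V := by linarith [hRpos a, mul_nonneg hℓ₀.le hV]
    calc _ ≤ ℓ₀ / (8 * ν) * (ν * V) := mul_le_mul_of_nonneg_left h1 (by positivity)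
      _ = _ := by field_simp
  have hγy : γ * ((1 + 1 / (ℓ₀ / (8 * ν))) * (y ⬝ᵥ P *ᵥ y)) ≤ ℓ₀ / 16 * V :=
    (mul_le_of_le_one_left (mul_nonneg (by positivity) (hPpos _)) hγ1).trans hPy
  have hyoungγ := mul_le_mul_of_nonneg_left hyoung hγ0.le
  linarith [mul_nonneg hℓ₀.le hV]

end Lyapunov

/-- every `K'` within `r₀ = min{D, ν/G}` of `K ∈ S_γ(ν)` lies in `S_γ(2ν)`. -/
theorem stmt8
    {n m p : ℕ} (hn : 1 ≤ n) (hm : 1 ≤ m) (hp : 1 ≤ p)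
    (A : Matrix (Fin n) (Fin n) ℝ) (B : Matrix (Fin n) (Fin m) ℝ) (C : Matrix (Fin p) (Fin n) ℝ)
    (Q : Matrix (Fin n) (Fin n) ℝ) (R : Matrix (Fin m) (Fin m) ℝ)
    (hQsymm : Q.IsSymm) (hRsymm : R.IsSymm)
    (ℓ₀ ℓ₁ ψ φ : ℝ) (hℓ₀ : 0 < ℓ₀) (hℓ₀₁ : ℓ₀ ≤ ℓ₁) (hψ : 1 ≤ ψ) (hφ : 1 ≤ φ)
    (hQlb : (Q - ℓ₀ • (1 : Matrix (Fin n) (Fin n) ℝ)).PosSemidef)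
    (hQub : (ℓ₁ • (1 : Matrix (Fin n) (Fin n) ℝ) - Q).PosSemidef)
    (hRlb : (R - ℓ₀ • (1 : Matrix (Fin m) (Fin m) ℝ)).PosSemidef)
    (hRub : (ℓ₁ • (1 : Matrix (Fin m) (Fin m) ℝ) - R).PosSemidef)
    (hB : spNorm B ≤ ψ) (hC : spNorm C ≤ φ)
    (γ : ℝ) (hγ : γ ∈ Set.Ioc (0 : ℝ) 1) (ν : ℝ) (hν : 0 < ν)
    (K : Matrix (Fin m) (Fin p) ℝ)
    (hK : inS A B C γ K) (hKν : Jcost A B C Q R γ K ≤ ν)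
    (K' : Matrix (Fin m) (Fin p) ℝ)
    (hKK' : spNorm (K' - K) ≤
      min (1 / (8 * Real.sqrt (ν / ℓ₀) ^ 3 * ψ * φ))
        (ν / (16 * Real.sqrt (ν / ℓ₀) ^ 9 * ℓ₁ * ψ * φ))) :
    inS A B C γ K' ∧ Jcost A B C Q R γ K' ≤ 2 * ν := by
  obtain ⟨hγ0, hγ1⟩ := hγ
  have hℓ₁ : 0 < ℓ₁ := hℓ₀.trans_le hℓ₀₁
  have hψ0 : 0 < ψ := zero_lt_one.trans_le hψ
  have hφ0 : 0 < φ := zero_lt_one.trans_le hφ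
  have hsum := summable_lyapunov hn (Acl A B C K) (Q + Cᵀ * Kᵀ * R * K * C) hγ0 hK
  have hRpos : ∀ w, 0 ≤ w ⬝ᵥ R *ᵥ w := fun w =>
    (mul_nonneg hℓ₀.le (dotProduct_self_nonneg w)).trans
      (smul_dotProduct_le_of_posSemidef R hRlb w)
  have hWlb : ∀ (L : Matrix (Fin m) (Fin p) ℝ) v, ℓ₀ * (v ⬝ᵥ v) ≤ v ⬝ᵥ (Q + Cᵀ * Lᵀ * R * L * C) *ᵥ v := fun L v => by
    rw [dotProduct_stageCost_mulVec]
    exact (smul_dotProduct_le_of_posSemidef Q hQlb v).trans (le_add_of_nonneg_right (hRpos _))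
  have hWpos : ∀ (L : Matrix (Fin m) (Fin p) ℝ) v, 0 ≤ v ⬝ᵥ (Q + Cᵀ * Lᵀ * R * L * C) *ᵥ v := fun L v =>
    (mul_nonneg hℓ₀.le (dotProduct_self_nonneg v)).trans (hWlb L v)
  set P := Pmat A B C Q R γ K with hP
  have hPpos : ∀ v, 0 ≤ v ⬝ᵥ P *ᵥ v := fun v =>
    (hasSum_dotProduct_mulVec hsum.hasSum v).nonneg fun t =>
      dotProduct_pow_mulVec_nonneg _ _ hγ0.le (hWpos K) t v
  have hlyap : ∀ v, v ⬝ᵥ P *ᵥ v = v ⬝ᵥ (Q + Cᵀ * Kᵀ * R * K * C) *ᵥ v +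
      γ * (Acl A B C K *ᵥ v ⬝ᵥ P *ᵥ (Acl A B C K *ᵥ v)) := fun v => by
    have h := congrArg (fun X => v ⬝ᵥ X *ᵥ v) (tsum_lyapunov_eq _ _ γ hsum)
    simp only [add_mulVec, smul_mulVec _ (_ * _ * _), dotProduct_add, dotProduct_smul,
      dotProduct_transpose_mul_mulVec, smul_eq_mul] at h
    rw [add_mulVec, dotProduct_add]
    exact h
  have htr : P.trace ≤ ν := hKν
  have hPub : ∀ v, v ⬝ᵥ P *ᵥ v ≤ ν * (v ⬝ᵥ v) := fun v =>
    (dotProduct_mulVec_le_trace_mul P hPpos v).trans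
      (mul_le_mul_of_nonneg_right htr (dotProduct_self_nonneg v))
  have hℓν : ℓ₀ ≤ ν := by
    have h1 := hPub (Pi.single ⟨0, hn⟩ 1)
    have h2 := hWlb K (Pi.single ⟨0, hn⟩ 1)
    rw [hlyap] at h1
    have h3 := mul_nonneg hγ0.le (hPpos (Acl A B C K *ᵥ Pi.single ⟨0, hn⟩ 1))
    have h4 : (Pi.single ⟨0, hn⟩ 1 : Fin n → ℝ) ⬝ᵥ Pi.single ⟨0, hn⟩ 1 = 1 := by simp
    rw [h4] at h1 h2
    linarith
  set κ := √(ν / ℓ₀) with hκ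
  have hκ2 : κ ^ 2 * ℓ₀ = ν := by
    rw [hκ, Real.sq_sqrt (by positivity), div_mul_cancel₀ _ hℓ₀.ne']
  have hκ1 : 1 ≤ κ := Real.one_le_sqrt.2 ((one_le_div hℓ₀).2 hℓν)
  have hκ0 : 0 < κ := zero_lt_one.trans_le hκ1
  set r := spNorm (K' - K) with hr
  have hr0 : 0 ≤ r := spNorm_nonneg _
  set ε := ψ * r * φ with hε
  have hε0 : 0 ≤ ε := by positivity
  obtain ⟨hℓ₁ε, hνε, hε1⟩ := perturbation_bounds hℓ₀ hℓ₀₁ hψ0 hφ0 hr0 hκ1 hκ2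
    (hKK'.trans (min_le_right _ _))
  have hrφ : r * φ ≤ ε := by
    rw [hε, mul_assoc]
    exact le_mul_of_one_le_left (by positivity) hψ
  have hΔ : ∀ v, (K' - K) *ᵥ (C *ᵥ v) ⬝ᵥ (K' - K) *ᵥ (C *ᵥ v) ≤ (r * φ) ^ 2 * (v ⬝ᵥ v) :=
    fun v => (mulVec_dotProduct_self_le _ hr.ge _).trans <| by
      rw [mul_pow, mul_assoc]
      exact mul_le_mul_of_nonneg_left (mulVec_dotProduct_self_le C hC v) (sq_nonneg r)
  have hE : ∀ v, B *ᵥ ((K' - K) *ᵥ (C *ᵥ v)) ⬝ᵥ B *ᵥ ((K' - K) *ᵥ (C *ᵥ v))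
      ≤ ε ^ 2 * (v ⬝ᵥ v) :=
    fun v => (mulVec_dotProduct_self_le B hB _).trans <| by
      rw [hε, mul_assoc ψ, mul_pow ψ, mul_assoc]
      exact mul_le_mul_of_nonneg_left (hΔ v) (sq_nonneg ψ)
  have hAcl : ∀ v, Acl A B C K' *ᵥ v =
      Acl A B C K *ᵥ v - B *ᵥ ((K' - K) *ᵥ (C *ᵥ v)) := fun v => by
    simp only [Acl, mulVec_mulVec, ← sub_mulVec, Matrix.mul_assoc, Matrix.sub_mul, Matrix.mul_sub]
    congr 1
    abel
  have hsuper : ∀ v, v ⬝ᵥ (Q + Cᵀ * K'ᵀ * R * K' * C) *ᵥ v +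
      γ * (Acl A B C K' *ᵥ v ⬝ᵥ ((2 : ℝ) • P) *ᵥ (Acl A B C K' *ᵥ v))
        ≤ v ⬝ᵥ ((2 : ℝ) • P) *ᵥ v := fun v => by
    have hK'v : K' *ᵥ (C *ᵥ v) = K *ᵥ (C *ᵥ v) + (K' - K) *ᵥ (C *ᵥ v) := by
      rw [sub_mulVec]; abel
    rw [dotProduct_stageCost_mulVec, hAcl, hK'v, smul_mulVec, dotProduct_smul, smul_mulVec,
      dotProduct_smul, smul_eq_mul, smul_eq_mul]
    refine two_mul_lyapunov_supersolution P Q R hγ0 hγ1 hℓ₀ hℓ₁ hν hε0 hℓ₁ε hνε hε1 hPpos hRpos hPub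
      (dotProduct_le_smul_of_posSemidef R hRub) (smul_dotProduct_le_of_posSemidef Q hQlb v) ?_
      (hE v) ((hΔ v).trans ?_)
    · rw [hlyap, dotProduct_stageCost_mulVec]
    · have := dotProduct_self_nonneg v
      gcongr
  have h2P : ∀ v, 0 ≤ v ⬝ᵥ ((2 : ℝ) • P) *ᵥ v := fun v => by
    rw [smul_mulVec, dotProduct_smul]
    exact mul_nonneg zero_le_two (hPpos v)
  refine ⟨sqrt_mul_specRad_lt_one _ _ _ hγ0 h2P (fun v hv => ?_) hsuper, ?_⟩
  · have hvv : 0 < v ⬝ᵥ v :=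
      (dotProduct_self_nonneg v).lt_of_ne' fun h => hv (dotProduct_self_eq_zero.1 h)
    exact (mul_pos hℓ₀ hvv).trans_le (hWlb K' v)
  · refine (trace_tsum_lyapunov_le _ _ _ hγ0.le h2P hsuper).trans ?_
    rw [trace_smul, smul_eq_mul]
    linarith
end

section
/- Under the discount-update hypotheses (γ ∈ (0,1), K ∈ S_γ with J_γ(K) > ℓ₀, Ĵ ∈ ℝ with |J_γ(K) − Ĵ| ≤ J_γ(K)/2, ζ ∈ (0,1), α = ℓ₀/(2Ĵ − ℓ₀), γ' = (1 + ζα)γ), it holds that √γ'·ρ(A − BKC) < 1 and, when γ' ≤ 1, the cost at the enlarged discount factor satisfies J_{γ'}(K) ≤ 8Ĵ³/((1 − ζ)ℓ₀²). -/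
open Matrix

section Lyapunov

variable {d : ℕ}

lemma posSemidef_trace_smul_one_sub {P : Matrix (Fin d) (Fin d) ℝ} (hP : P.PosSemidef) :
    (P.trace • (1 : Matrix (Fin d) (Fin d) ℝ) - P).PosSemidef := by
  obtain ⟨k, v, rfl⟩ := Matrix.posSemidef_iff_eq_sum_vecMulVec.mp hP
  rw [Matrix.trace_sum, Finset.sum_smul, ← Finset.sum_sub_distrib]
  refine Matrix.posSemidef_sum _ fun i _ => ?_
  refine .of_dotProduct_mulVec_nonneg ?_ fun x => ?_
  · exact (Matrix.isHermitian_one.smul (IsSelfAdjoint.all _)).sub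
      (Matrix.posSemidef_vecMulVec_self_star (v i)).1
  · have h := Finset.sum_mul_sq_le_sq_mul_sq Finset.univ (v i) x
    simp only [star_trivial, Matrix.trace_vecMulVec, Matrix.sub_mulVec, Matrix.smul_mulVec,
      Matrix.one_mulVec, dotProduct_sub, dotProduct_smul, Matrix.vecMulVec_mulVec,
      op_smul_eq_smul, smul_eq_mul, sub_nonneg]
    rw [dotProduct_comm x (v i)]
    simpa only [dotProduct, ← pow_two] using h

lemma posSemidef_transpose_mul_mul {P : Matrix (Fin d) (Fin d) ℝ} (hP : P.PosSemidef) {k : ℕ}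
    (M : Matrix (Fin d) (Fin k) ℝ) : (Mᵀ * P * M).PosSemidef := by
  simpa only [Matrix.conjTranspose_eq_transpose_of_trivial] using hP.conjTranspose_mul_mul_same M

lemma posSemidef_of_hasSum {f : ℕ → Matrix (Fin d) (Fin d) ℝ} {P : Matrix (Fin d) (Fin d) ℝ}
    (hf : ∀ t, (f t).PosSemidef) (hP : HasSum f P) : P.PosSemidef := by
  refine .of_dotProduct_mulVec_nonneg ?_ fun x => ?_
  · have h := hP.matrix_conjTranspose
    simp only [fun t => (hf t).1.eq] at h
    exact h.unique hP
  · let q : Matrix (Fin d) (Fin d) ℝ →+ ℝ :=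
      { toFun := fun N => star x ⬝ᵥ (N *ᵥ x)
        map_zero' := by simp
        map_add' := fun N N' => by rw [Matrix.add_mulVec, dotProduct_add] }
    have hq : Continuous q :=
      continuous_const.dotProduct (continuous_id.matrix_mulVec continuous_const)
    exact (hP.map q hq).nonneg fun t => (hf t).dotProduct_mulVec_nonneg x

lemma lyapunov_equation_of_hasSum {M X P : Matrix (Fin d) (Fin d) ℝ} {γ : ℝ}
    (hP : HasSum (fun t : ℕ => γ ^ t • (Mᵀ ^ t * X * M ^ t)) P) :
    P = X + γ • (Mᵀ * P * M) := by
  let q : Matrix (Fin d) (Fin d) ℝ →+ Matrix (Fin d) (Fin d) ℝ :=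
    { toFun := fun N => γ • (Mᵀ * N * M)
      map_zero' := by simp
      map_add' := fun N N' => by rw [mul_add, add_mul, smul_add] }
  have hq : Continuous q :=
    ((continuous_const.matrix_mul continuous_id).matrix_mul continuous_const).const_smul γ
  have h := hP.map q hq
  have hs := (hasSum_nat_add_iff' 1).mpr hP
  have he : (q ∘ fun t : ℕ => γ ^ t • (Mᵀ ^ t * X * M ^ t)) =
      fun t : ℕ => γ ^ (t + 1) • (Mᵀ ^ (t + 1) * X * M ^ (t + 1)) := by
    funext t
    change γ • (Mᵀ * (γ ^ t • (Mᵀ ^ t * X * M ^ t)) * M) = _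
    rw [pow_succ' Mᵀ, pow_succ M, pow_succ' γ, Matrix.mul_smul, Matrix.smul_mul, smul_smul]
    simp only [mul_assoc]
  rw [he] at h
  have := h.unique hs
  simp only [Finset.range_one, Finset.sum_singleton, pow_zero, one_smul, one_mul, mul_one] at this
  rw [eq_sub_iff_add_eq, add_comm] at this
  exact this.symm

lemma posSemidef_pow_smul_sub {M P : Matrix (Fin d) (Fin d) ℝ} {γ r : ℝ} (hγ : 0 ≤ γ) (hr : 0 ≤ r)
    (h : (r • P - γ • (Mᵀ * P * M)).PosSemidef) (t : ℕ) :
    (r ^ t • P - γ ^ t • (Mᵀ ^ t * P * M ^ t)).PosSemidef := by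
  induction t with
  | zero => simpa using Matrix.PosSemidef.zero
  | succ t ih =>
    have := (h.smul (pow_nonneg hr t)).add ((posSemidef_transpose_mul_mul ih M).smul hγ)
    convert! this using 1
    rw [pow_succ' Mᵀ, pow_succ M, pow_succ' γ, pow_succ r]
    simp only [mul_sub, sub_mul, smul_sub, Matrix.mul_smul, Matrix.smul_mul, smul_smul, mul_assoc,
      mul_comm (r ^ t) γ]
    abel

lemma norm_sq_le_of_mem_spectrum {M P : Matrix (Fin d) (Fin d) ℝ} {γ r : ℝ} (hP : P.PosDef)
    (h : (r • P - γ • (Mᵀ * P * M)).PosSemidef) {μ : ℂ}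
    (hμ : μ ∈ spectrum ℂ (M.map (algebraMap ℝ ℂ))) : γ * ‖μ‖ ^ 2 ≤ r := by
  rw [← Matrix.spectrum_toLin', ← Module.End.hasEigenvalue_iff_mem_spectrum] at hμ
  obtain ⟨v, hv⟩ := hμ.exists_hasEigenvector
  have hv1 : (M.map (algebraMap ℝ ℂ)) *ᵥ v = μ • v := by simpa using hv.apply_eq_smul
  set x : Fin d → ℝ := fun i => (v i).re with hx
  set y : Fin d → ℝ := fun i => (v i).im with hy
  have hMx : M *ᵥ x = μ.re • x - μ.im • y := by
    funext i
    have := congrArg Complex.re (congrFun hv1 i)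
    simpa [Matrix.mulVec, dotProduct, hx, hy] using this
  have hMy : M *ᵥ y = μ.re • y + μ.im • x := by
    funext i
    have := congrArg Complex.im (congrFun hv1 i)
    simpa [Matrix.mulVec, dotProduct, hx, hy] using this
  have hsymm : y ⬝ᵥ (P *ᵥ x) = x ⬝ᵥ (P *ᵥ y) := by
    have : Pᵀ = P := by simpa using hP.1.eq
    rw [dotProduct_comm, Matrix.dotProduct_mulVec, ← Matrix.mulVec_transpose, this]
  have hpos : 0 < x ⬝ᵥ (P *ᵥ x) + y ⬝ᵥ (P *ᵥ y) := by
    have h0 : x ≠ 0 ∨ y ≠ 0 := by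
      by_contra! hc
      refine hv.2 (funext fun i => Complex.ext ?_ ?_)
      · exact congrFun hc.1 i
      · exact congrFun hc.2 i
    have hx0 := hP.posSemidef.dotProduct_mulVec_nonneg x
    have hy0 := hP.posSemidef.dotProduct_mulVec_nonneg y
    simp only [star_trivial] at hx0 hy0
    rcases h0 with h0 | h0
    · have := hP.dotProduct_mulVec_pos h0
      simp only [star_trivial] at this
      linarith
    · have := hP.dotProduct_mulVec_pos h0
      simp only [star_trivial] at this
      linarith
  have key (z : Fin d → ℝ) : γ * ((M *ᵥ z) ⬝ᵥ (P *ᵥ (M *ᵥ z))) ≤ r * (z ⬝ᵥ (P *ᵥ z)) := by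
    have hz := h.dotProduct_mulVec_nonneg z
    simp only [star_trivial, Matrix.sub_mulVec, Matrix.smul_mulVec, dotProduct_sub, dotProduct_smul,
      smul_eq_mul, sub_nonneg, ← Matrix.mulVec_mulVec] at hz
    rwa [Matrix.dotProduct_mulVec z Mᵀ, Matrix.vecMul_transpose] at hz
  have kx := key x
  have ky := key y
  rw [hMx] at kx
  rw [hMy] at ky
  simp only [Matrix.mulVec_add, Matrix.mulVec_sub, Matrix.mulVec_smul, dotProduct_add,
    dotProduct_sub, add_dotProduct, sub_dotProduct, dotProduct_smul, smul_dotProduct, smul_eq_mul,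
    hsymm] at kx ky
  rw [← Complex.normSq_eq_norm_sq, Complex.normSq_apply]
  refine le_of_mul_le_mul_right ?_ hpos
  linarith

lemma sqrt_mul_specRad_lt_one_s15 {M P : Matrix (Fin d) (Fin d) ℝ} {γ r : ℝ} (hγ : 0 < γ)
    (hr : 0 ≤ r) (hr1 : r < 1) (hP : P.PosDef)
    (h : (r • P - γ • (Mᵀ * P * M)).PosSemidef) : Real.sqrt γ * specRad M < 1 := by
  have hs : specRad M ≤ Real.sqrt r / Real.sqrt γ := by
    refine Real.sSup_le ?_ (by positivity)
    rintro _ ⟨μ, hμ, rfl⟩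
    rw [← Real.sqrt_div hr]
    refine Real.le_sqrt_of_sq_le ?_
    rw [le_div_iff₀ hγ, mul_comm]
    exact norm_sq_le_of_mem_spectrum hP h hμ
  rw [le_div_iff₀ (Real.sqrt_pos.mpr hγ), mul_comm] at hs
  exact hs.trans_lt ((Real.sqrt_lt' one_pos).mpr (by simpa using hr1))

lemma trace_tsum_le {M X P : Matrix (Fin d) (Fin d) ℝ} {γ r : ℝ} (hγ : 0 ≤ γ) (hr : 0 ≤ r)
    (hr1 : r < 1) (hP : P.PosSemidef) (hXP : (P - X).PosSemidef)
    (h : (r • P - γ • (Mᵀ * P * M)).PosSemidef) :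
    (∑' t : ℕ, γ ^ t • (Mᵀ ^ t * X * M ^ t)).trace ≤ P.trace / (1 - r) := by
  by_cases hs : Summable fun t : ℕ => γ ^ t • (Mᵀ ^ t * X * M ^ t)
  · have h1 := hs.hasSum.map (Matrix.traceAddMonoidHom (Fin d) ℝ) continuous_id.matrix_trace
    have h2 := (hasSum_geometric_of_lt_one hr hr1).mul_right P.trace
    rw [div_eq_inv_mul]
    refine hasSum_le (fun t => ?_) h1 h2
    have ht := (posSemidef_pow_smul_sub hγ hr h t).add
      ((posSemidef_transpose_mul_mul hXP (M ^ t)).smul (pow_nonneg hγ t))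
    have := ht.trace_nonneg
    rw [Matrix.transpose_pow, mul_sub, sub_mul, smul_sub, sub_add_sub_cancel, Matrix.trace_sub,
      Matrix.trace_smul, smul_eq_mul, sub_nonneg] at this
    exact this
  · rw [tsum_eq_zero_of_not_summable hs, Matrix.trace_zero]
    exact div_nonneg hP.trace_nonneg (by linarith)

end Lyapunov

/-- `√γ'·ρ(A − BKC) < 1` and, if `γ' ≤ 1`, then
`J_{γ'}(K) ≤ 8Jhat³/((1 − ζ)ℓ₀²)`. -/
theorem stmt15
    {n m p : ℕ} (hn : 1 ≤ n) (hm : 1 ≤ m) (hp : 1 ≤ p)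
    (A : Matrix (Fin n) (Fin n) ℝ) (B : Matrix (Fin n) (Fin m) ℝ) (C : Matrix (Fin p) (Fin n) ℝ)
    (Q : Matrix (Fin n) (Fin n) ℝ) (R : Matrix (Fin m) (Fin m) ℝ)
    (hQsymm : Q.IsSymm) (hRsymm : R.IsSymm)
    (ℓ₀ ℓ₁ ψ φ : ℝ) (hℓ₀ : 0 < ℓ₀) (hℓ₀₁ : ℓ₀ ≤ ℓ₁) (hψ : 1 ≤ ψ) (hφ : 1 ≤ φ)
    (hQlb : (Q - ℓ₀ • (1 : Matrix (Fin n) (Fin n) ℝ)).PosSemidef)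
    (hQub : (ℓ₁ • (1 : Matrix (Fin n) (Fin n) ℝ) - Q).PosSemidef)
    (hRlb : (R - ℓ₀ • (1 : Matrix (Fin m) (Fin m) ℝ)).PosSemidef)
    (hRub : (ℓ₁ • (1 : Matrix (Fin m) (Fin m) ℝ) - R).PosSemidef)
    (hB : spNorm B ≤ ψ) (hC : spNorm C ≤ φ)
    (γ : ℝ) (hγ : γ ∈ Set.Ioo (0 : ℝ) 1)
    (K : Matrix (Fin m) (Fin p) ℝ) (hK : inS A B C γ K)
    (hJ : ℓ₀ < Jcost A B C Q R γ K)
    (Jhat : ℝ) (hJhat : |Jcost A B C Q R γ K - Jhat| ≤ Jcost A B C Q R γ K / 2)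
    (ζ : ℝ) (hζ : ζ ∈ Set.Ioo (0 : ℝ) 1)
    (γ' : ℝ) (hγ' : γ' = (1 + ζ * (ℓ₀ / (2 * Jhat - ℓ₀))) * γ) :
    Real.sqrt γ' * specRad (Acl A B C K) < 1 ∧
      (γ' ≤ 1 → Jcost A B C Q R γ' K ≤ 8 * Jhat ^ 3 / ((1 - ζ) * ℓ₀ ^ 2)) := by
  obtain ⟨hγ0, -⟩ := hγ
  obtain ⟨hζ0, hζ1⟩ := hζ
  set M := Acl A B C K with hM
  set X := Q + Cᵀ * Kᵀ * R * K * C with hX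
  set P := Pmat A B C Q R γ K with hPdef
  set J := Jcost A B C Q R γ K with hJdef
  have hJP : P.trace = J := rfl
  have hJ0 : 0 < J := hℓ₀.trans hJ
  have hsum : HasSum (fun t : ℕ => γ ^ t • (Mᵀ ^ t * X * M ^ t)) P := by
    by_contra hs
    have hP0 : P = 0 := tsum_eq_zero_of_not_summable fun hs' => hs hs'.hasSum
    rw [hP0, Matrix.trace_zero] at hJP
    exact hJ0.ne hJP
  have hRpsd : R.PosSemidef := by
    have := hRlb.add (Matrix.PosSemidef.one.smul hℓ₀.le)
    rwa [sub_add_cancel] at this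
  have hXlb : (X - ℓ₀ • (1 : Matrix (Fin n) (Fin n) ℝ)).PosSemidef := by
    have := hQlb.add (posSemidef_transpose_mul_mul hRpsd (K * C))
    convert! this using 1
    rw [hX, Matrix.transpose_mul]
    simp only [Matrix.mul_assoc]
    abel
  have hXpsd : X.PosSemidef := by
    have := hXlb.add (Matrix.PosSemidef.one.smul hℓ₀.le)
    rwa [sub_add_cancel] at this
  have hPpsd : P.PosSemidef := by
    refine posSemidef_of_hasSum (fun t => ?_) hsum
    rw [← Matrix.transpose_pow]
    exact (posSemidef_transpose_mul_mul hXpsd _).smul (pow_nonneg hγ0.le t)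
  have hlyap : P = X + γ • (Mᵀ * P * M) := lyapunov_equation_of_hasSum hsum
  have hPX : (P - X).PosSemidef := by
    have := (posSemidef_transpose_mul_mul hPpsd M).smul hγ0.le
    rwa [← sub_eq_iff_eq_add'.mpr hlyap] at this
  have hPpos : P.PosDef := by
    have := (Matrix.PosDef.one.smul hℓ₀).add_posSemidef (hXlb.add hPX)
    convert! this using 1
    abel
  have hPub := posSemidef_trace_smul_one_sub hPpsd
  rw [hJP] at hPub
  obtain ⟨hJ1, hJ2⟩ := abs_le.mp hJhat
  have hJle : J ≤ 2 * Jhat := by linarith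
  set α := ℓ₀ / (2 * Jhat - ℓ₀) with hα
  have hα0 : 0 < α := div_pos hℓ₀ (by linarith)
  have hαle : α * (J - ℓ₀) ≤ ℓ₀ := by
    rw [hα, div_mul_eq_mul_div, div_le_iff₀ (by linarith)]
    exact mul_le_mul_of_nonneg_left (by linarith) hℓ₀.le
  have hc : 0 < 1 + ζ * α := by positivity
  have hγ'0 : 0 < γ' := hγ' ▸ mul_pos hc hγ0
  set r := 1 - (1 - ζ) * ℓ₀ / J with hr
  have hgap : 0 < (1 - ζ) * ℓ₀ / J := by
    have : 0 < 1 - ζ := by linarith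
    positivity
  have hr1 : r < 1 := by linarith
  have hr0 : 0 ≤ r := by
    rw [hr, sub_nonneg, div_le_one hJ0]
    nlinarith
  have hcr : (1 + ζ * α) * (1 - ℓ₀ / J) ≤ r := by
    have : r - (1 + ζ * α) * (1 - ℓ₀ / J) = ζ * (ℓ₀ - α * (J - ℓ₀)) / J := by
      rw [hr]
      field_simp
      ring
    have h0 : 0 ≤ ζ * (ℓ₀ - α * (J - ℓ₀)) / J :=
      div_nonneg (mul_nonneg hζ0.le (by linarith)) hJ0.le
    linarith
  have hcontr : (r • P - γ' • (Mᵀ * P * M)).PosSemidef := by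
    have := ((hXlb.smul hc.le).add (hPub.smul (mul_nonneg hc.le (div_pos hℓ₀ hJ0).le))).add
      (hPpsd.smul (sub_nonneg.mpr hcr))
    convert! this using 1
    rw [hγ', ← smul_smul, ← sub_eq_iff_eq_add'.mpr hlyap]
    have hcancel : (1 + ζ * α) * (ℓ₀ / J) * J = (1 + ζ * α) * ℓ₀ := by field_simp
    simp only [smul_sub, smul_smul, hcancel]
    module
  refine ⟨sqrt_mul_specRad_lt_one_s15 hγ'0 hr0 hr1 hPpos hcontr, fun _ => ?_⟩
  have hb : Jcost A B C Q R γ' K ≤ J / (1 - r) :=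
    trace_tsum_le hγ'0.le hr0 hr1 hPpsd hPX hcontr
  refine hb.trans ?_
  have hζ' : 0 < 1 - ζ := by linarith
  have he : J / (1 - r) = J ^ 2 * ℓ₀ / ((1 - ζ) * ℓ₀ ^ 2) := by
    rw [hr, sub_sub_cancel]
    field_simp
  rw [he]
  refine div_le_div_of_nonneg_right ?_ (by positivity)
  calc J ^ 2 * ℓ₀ ≤ (2 * Jhat) ^ 2 * (2 * Jhat) := by gcongr; linarith
    _ = 8 * Jhat ^ 3 := by ring
end
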